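/- Let n ≥ 2 and let W be a normalized 2×n entanglement witness with eigenvalues λ_1 ≥ λ_2 ≥ … ≥ λ_{2n} listed in non-increasing order with multiplicity. Then for every integer k with 4 ≤ k ≤ 2n, the sum of the 2n − k + 1 smallest eigenvalues satisfies ∑_{i=k}^{2n} λ_i ≥ −1/2. -/

import Mathlib

open Matrix ComplexOrder

noncomputable section

/-- The product vector `a ⊗ b`. -/
def prodVec {m n : ℕ} (a : Fin m → ℂ) (b : Fin n → ℂ) : Fin m × Fin n → ℂ :=
  fun p => a p.1 * b p.2

/-- `W` is block-positive: Hermitian, and the quadratic form on every product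
vector is real and nonnegative. -/
def BlockPositive {m n : ℕ} (W : Matrix (Fin m × Fin n) (Fin m × Fin n) ℂ) : Prop :=
  W.IsHermitian ∧ ∀ (a : Fin m → ℂ) (b : Fin n → ℂ),
    0 ≤ (star (prodVec a b) ⬝ᵥ W.mulVec (prodVec a b)).re ∧
    (star (prodVec a b) ⬝ᵥ W.mulVec (prodVec a b)).im = 0

/-- Partial transpose: `M^Γ ((i,k),(j,l)) = M ((j,k),(i,l))`. -/
def ptrans {m n : ℕ} (M : Matrix (Fin m × Fin n) (Fin m × Fin n) ℂ) :
    Matrix (Fin m × Fin n) (Fin m × Fin n) ℂ :=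
  fun p q => M (q.1, p.2) (p.1, q.2)

/-- `W` is decomposable: `W = P + Q^Γ` with `P, Q` positive semidefinite. -/
def Decomposable {m n : ℕ} (W : Matrix (Fin m × Fin n) (Fin m × Fin n) ℂ) : Prop :=
  ∃ P Q : Matrix (Fin m × Fin n) (Fin m × Fin n) ℂ,
    P.PosSemidef ∧ Q.PosSemidef ∧ W = P + ptrans Q

/-- Negativity: absolute value of the sum of the negative eigenvalues. -/
noncomputable def negativity {N : Type*} [Fintype N] [DecidableEq N]
    {W : Matrix N N ℂ} (hW : W.IsHermitian) : ℝ :=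
  ∑ i, max (-(hW.eigenvalues i)) 0

/-- The eigenvalues of a Hermitian matrix, listed in non-increasing order with
multiplicity. -/
noncomputable def sortedEigs {N : Type*} [Fintype N] [DecidableEq N]
    {W : Matrix N N ℂ} (hW : W.IsHermitian) : List ℝ :=
  (Finset.univ.val.map hW.eigenvalues).sort (· ≥ ·)

lemma aux_sublist {N : Type*} [Fintype N] [DecidableEq N] (f : N → ℝ) (l : List ℝ)
    (h : (l : Multiset ℝ) ≤ Finset.univ.val.map f) :
    ∃ S : Finset N, l.sum = ∑ i ∈ S, f i := by
  have h1 : ((Finset.univ : Finset N).val) = ((Finset.univ : Finset N).toList : Multiset N) := by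
    simp
  rw [h1, Multiset.map_coe, Multiset.coe_le] at h
  obtain ⟨l', hp, hs⟩ := h
  obtain ⟨m, hm, rfl⟩ := List.sublist_map_iff.1 hs
  refine ⟨m.toFinset, ?_⟩
  rw [← hp.sum_eq, List.sum_toFinset]
  exact hm.nodup (Finset.nodup_toList _)

lemma aux_trace {N : Type*} [Fintype N] [DecidableEq N] {Q M : Matrix N N ℂ}
    (hQ : Q.PosSemidef) (hM : M.PosSemidef) : 0 ≤ (Q * M).trace.re := by
  obtain ⟨B, rfl⟩ : ∃ B : Matrix N N ℂ, Q = Bᴴ * B := by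
    open scoped MatrixOrder Matrix.Norms.L2Operator in
    exact CStarAlgebra.nonneg_iff_eq_star_mul_self.1 hQ.nonneg
  rw [Matrix.mul_assoc, Matrix.trace_mul_comm]
  exact (Complex.le_def.1 (hM.mul_mul_conjTranspose_same B).trace_nonneg).1

open scoped Matrix.Norms.L2Operator in
lemma aux_spec {N : Type*} [Fintype N] [DecidableEq N] (V : Matrix N N ℂ)
    (hV : V ∈ unitary (Matrix N N ℂ)) :
    ∃ (s : Finset ℂ) (E : ℂ → Matrix N N ℂ), (∀ z ∈ s, ‖z‖ = 1) ∧ (∀ z, (E z).PosSemidef) ∧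
      ∑ z ∈ s, E z = 1 ∧ ∑ z ∈ s, z • E z = V := by
  have hn : IsStarNormal V := ⟨by
    rw [commute_iff_eq, (Unitary.mem_iff.1 hV).1, (Unitary.mem_iff.1 hV).2]⟩
  have hfin := Matrix.finite_spectrum V
  have hc : ∀ g : ℂ → ℂ, ContinuousOn g (spectrum ℂ V) := fun g => hfin.continuousOn g
  let e : ℂ → ℂ → ℂ := fun z w => if w = z then 1 else 0
  refine ⟨hfin.toFinset, fun z => cfc (e z) V, ?_, ?_, ?_, ?_⟩
  · intro z hz
    exact spectrum.norm_eq_one_of_unitary hV (hfin.mem_toFinset.1 hz)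
  · intro z
    have : cfc (e z) V = (cfc (e z) V)ᴴ * cfc (e z) V := by
      rw [← Matrix.star_eq_conjTranspose, ← cfc_star, ← cfc_mul _ _ V (hc _) (hc _)]
      congr 1
      ext w
      by_cases h : w = z <;> simp [e, h]
    change (cfc (e z) V).PosSemidef
    rw [this]
    exact Matrix.posSemidef_conjTranspose_mul_self _
  · rw [← cfc_sum _ V _ (fun i _ => hc _), ← cfc_const_one ℂ V]
    apply cfc_congr
    intro w hw
    simp [e, hw]
  · have : ∀ z, z • cfc (e z) V = cfc (fun w => z * e z w) V := fun z =>
      (cfc_const_mul z (e z) V (hc _)).symm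
    simp_rw [this]
    rw [← cfc_sum _ V _ (fun i _ => hc _)]
    conv_rhs => rw [← cfc_id' ℂ V]
    apply cfc_congr
    intro w hw
    simp [e, hw]

def blk {n : ℕ} (W : Matrix (Fin 2 × Fin n) (Fin 2 × Fin n) ℂ) (i j : Fin 2) :
    Matrix (Fin n) (Fin n) ℂ := W.submatrix (fun k => (i, k)) (fun k => (j, k))

lemma aux_blk_trace {n : ℕ} (P W : Matrix (Fin 2 × Fin n) (Fin 2 × Fin n) ℂ) :
    (P * W).trace = (blk P 0 0 * blk W 0 0).trace + (blk P 0 1 * blk W 1 0).trace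
      + (blk P 1 0 * blk W 0 1).trace + (blk P 1 1 * blk W 1 1).trace := by
  simp only [Matrix.trace, Matrix.diag, Matrix.mul_apply, blk, Matrix.submatrix_apply,
    Fintype.sum_prod_type, Fin.sum_univ_two, Finset.sum_add_distrib]
  ring

lemma aux_herm {n : ℕ} {W : Matrix (Fin 2 × Fin n) (Fin 2 × Fin n) ℂ}
    (hW : W.IsHermitian) (i j : Fin 2) : (blk W i j)ᴴ = blk W j i := by
  ext k l
  exact hW.apply _ _

lemma aux_form {n : ℕ} (W : Matrix (Fin 2 × Fin n) (Fin 2 × Fin n) ℂ)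
    (a : Fin 2 → ℂ) (b : Fin n → ℂ) :
    star (prodVec a b) ⬝ᵥ W.mulVec (prodVec a b) =
      star b ⬝ᵥ ((∑ i, ∑ j, (star (a i) * a j) • blk W i j) *ᵥ b) := by
  simp only [dotProduct, Matrix.mulVec, prodVec, Pi.star_apply, Fintype.sum_prod_type,
    Matrix.sum_apply, Fin.sum_univ_two, Matrix.add_apply, Matrix.smul_apply, blk,
    Matrix.submatrix_apply, smul_eq_mul, star_mul', Finset.mul_sum, Finset.sum_add_distrib,
    mul_add, add_mul]
  simp only [← Finset.sum_add_distrib]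
  refine Finset.sum_congr rfl fun x _ => ?_
  refine Finset.sum_congr rfl fun y _ => ?_
  ring

lemma aux_psd {n : ℕ} {W : Matrix (Fin 2 × Fin n) (Fin 2 × Fin n) ℂ}
    (hBP : BlockPositive W) (a : Fin 2 → ℂ) :
    (∑ i, ∑ j, (star (a i) * a j) • blk W i j).PosSemidef := by
  refine .of_dotProduct_mulVec_nonneg ?_ fun b => ?_
  · simp only [Matrix.IsHermitian, Matrix.conjTranspose_sum, Matrix.conjTranspose_smul,
      aux_herm hBP.1, star_mul', star_star]
    rw [Finset.sum_comm]
    simp only [mul_comm]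
  · rw [← aux_form, Complex.le_def]
    exact ⟨(hBP.2 a b).1, (hBP.2 a b).2.symm⟩

lemma aux_proj {n : ℕ} {W P : Matrix (Fin 2 × Fin n) (Fin 2 × Fin n) ℂ}
    (hBP : BlockPositive W) (hP : P.IsHermitian) (hPP : P * P = P) :
    0 ≤ (P * W).trace.re + (1 / 2) * W.trace.re := by
  have hPs : P.PosSemidef := by
    have : P = Pᴴ * P := by rw [hP.eq, hPP]
    rw [this]
    exact Matrix.posSemidef_conjTranspose_mul_self _
  let sw : Fin 2 × Fin n ≃ Fin 2 × Fin n := (Equiv.swap 0 1).prodCongr (Equiv.refl _)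
  let R : Matrix (Fin 2 × Fin n) (Fin 2 × Fin n) ℂ := (2 : ℂ) • P - 1
  have hRh : Rᴴ = R := by simp [R, hP.eq]
  have hRR : R * R = 1 := by
    simp only [R, sub_mul, mul_sub, smul_mul_smul_comm, hPP, mul_one, one_mul]
    module
  have hV : R.submatrix id sw ∈ unitary (Matrix (Fin 2 × Fin n) (Fin 2 × Fin n) ℂ) := by
    rw [Matrix.mem_unitaryGroup_iff, Matrix.star_eq_conjTranspose, Matrix.conjTranspose_submatrix,
      Matrix.submatrix_mul_equiv, hRh, hRR]
    simp
  obtain ⟨s, E, hs, hE, h1, hsum⟩ := aux_spec _ hV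
  have hB : blk P 0 1 = ∑ z ∈ s, ((1 / 2 : ℂ) * z) • blk (E z) 0 0 := by
    ext k l
    have := congrFun (congrFun hsum (0, k)) (0, l)
    simp only [Matrix.sum_apply, Matrix.smul_apply, smul_eq_mul, Matrix.submatrix_apply, id, R, sw,
      Matrix.sub_apply, blk, mul_assoc, ← Finset.mul_sum] at this ⊢
    rw [this]
    simp [Matrix.one_apply]
  have hBs : blk P 1 0 = ∑ z ∈ s, ((1 / 2 : ℂ) * star z) • blk (E z) 0 0 := by
    rw [← aux_herm hP 0 1, hB, Matrix.conjTranspose_sum]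
    refine Finset.sum_congr rfl fun z _ => ?_
    rw [Matrix.conjTranspose_smul, aux_herm (hE z).1]
    simp
  have hI : (1 : Matrix (Fin n) (Fin n) ℂ) = ∑ z ∈ s, blk (E z) 0 0 := by
    ext k l
    have := congrFun (congrFun h1 (0, k)) (0, l)
    simp only [Matrix.sum_apply, blk, Matrix.submatrix_apply] at this ⊢
    rw [this]
    simp [Matrix.one_apply]
  have hWtr : W.trace = (blk W 0 0).trace + (blk W 1 1).trace := by
    simp [Matrix.trace, blk, Fintype.sum_prod_type, Fin.sum_univ_two]
  have hA := aux_psd hBP ![1, 0]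
  have hC := aux_psd hBP ![0, 1]
  simp only [Fin.sum_univ_two, Matrix.cons_val_zero, Matrix.cons_val_one, star_one, star_zero,
    mul_zero, zero_mul, one_mul, one_smul, zero_smul, add_zero, zero_add] at hA hC
  have tA := aux_trace (hPs.submatrix (fun k : Fin n => ((0 : Fin 2), k))) hA
  have tC := aux_trace (hPs.submatrix (fun k : Fin n => ((1 : Fin 2), k))) hC
  have key : (blk P 0 1 * blk W 1 0).trace + (blk P 1 0 * blk W 0 1).trace + (1 / 2) * W.trace
      = ∑ z ∈ s, (1 / 2) * (blk (E z) 0 0 *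
        (blk W 0 0 + blk W 1 1 + z • blk W 1 0 + star z • blk W 0 1)).trace := by
    have hT : ∀ X : Matrix (Fin n) (Fin n) ℂ, X.trace = ∑ z ∈ s, (blk (E z) 0 0 * X).trace := by
      intro X
      rw [← Matrix.trace_sum, ← Finset.sum_mul, ← hI, one_mul]
    rw [hWtr, hT (blk W 0 0), hT (blk W 1 1), hB, hBs]
    simp only [Finset.sum_mul, Matrix.trace_sum, Finset.mul_sum, ← Finset.sum_add_distrib]
    refine Finset.sum_congr rfl fun z _ => ?_
    simp only [mul_add, Matrix.trace_add, Matrix.smul_mul, Matrix.mul_smul, Matrix.trace_smul,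
      smul_eq_mul, one_mul]
    ring
  have key2 : 0 ≤ ((blk P 0 1 * blk W 1 0).trace + (blk P 1 0 * blk W 0 1).trace
      + (1 / 2) * W.trace).re := by
    rw [key, Complex.re_sum]
    refine Finset.sum_nonneg fun z hz => ?_
    have hM := aux_psd hBP ![1, star z]
    have hzz : z * star z = 1 := by
      have := Complex.mul_conj z
      rw [Complex.normSq_eq_norm_sq, hs z hz] at this
      simpa using this
    simp only [Fin.sum_univ_two, Matrix.cons_val_zero, Matrix.cons_val_one, star_one, star_star,
      mul_one, one_mul, one_smul, hzz] at hM
    have h := aux_trace ((hE z).submatrix (fun k : Fin n => ((0 : Fin 2), k))) hM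
    have e1 : blk W 0 0 + blk W 1 1 + z • blk W 1 0 + star z • blk W 0 1
        = blk W 0 0 + star z • blk W 0 1 + (z • blk W 1 0 + blk W 1 1) := by abel
    rw [e1]
    have e2 : ∀ w : ℂ, ((1 / 2 : ℂ) * w).re = 1 / 2 * w.re := by
      intro w; simp [Complex.mul_re]
    rw [e2]
    exact mul_nonneg (by norm_num) h
  rw [aux_blk_trace P W]
  have e2 : ∀ w : ℂ, ((1 / 2 : ℂ) * w).re = 1 / 2 * w.re := by
    intro w; simp [Complex.mul_re]
  simp only [Complex.add_re, e2] at key2 ⊢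
  change 0 ≤ (blk P 0 0 * blk W 0 0).trace.re at tA
  change 0 ≤ (blk P 1 1 * blk W 1 1).trace.re at tC
  linarith

lemma aux_main {n : ℕ} (W : Matrix (Fin 2 × Fin n) (Fin 2 × Fin n) ℂ)
    (hBP : BlockPositive W) (htr : W.trace = 1) (S : Finset (Fin 2 × Fin n)) :
    -(1 / 2) ≤ ∑ i ∈ S, hBP.1.eigenvalues i := by
  let U : Matrix (Fin 2 × Fin n) (Fin 2 × Fin n) ℂ := hBP.1.eigenvectorUnitary
  let L : Matrix (Fin 2 × Fin n) (Fin 2 × Fin n) ℂ :=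
    diagonal (fun i => ((hBP.1.eigenvalues i : ℝ) : ℂ))
  let D : Matrix (Fin 2 × Fin n) (Fin 2 × Fin n) ℂ := diagonal (fun i => if i ∈ S then 1 else 0)
  have hU : star U * U = 1 := Unitary.coe_star_mul_self _
  have hW : W = U * L * star U := by
    have := hBP.1.spectral_theorem
    rw [Unitary.conjStarAlgAut_apply] at this
    exact this
  have hDD : D * D = D := by simp [D, Matrix.diagonal_mul_diagonal]
  have hDh : Dᴴ = D := by
    simp only [D, Matrix.diagonal_conjTranspose]
    congr 1
    ext i
    by_cases h : i ∈ S <;> simp [h]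
  have hmul : ∀ X Y : Matrix (Fin 2 × Fin n) (Fin 2 × Fin n) ℂ,
      (U * X * star U) * (U * Y * star U) = U * (X * Y) * star U := by
    intro X Y
    calc (U * X * star U) * (U * Y * star U) = U * X * (star U * U) * Y * star U := by
          simp only [mul_assoc]
      _ = _ := by rw [hU, mul_one, mul_assoc U X Y]
  have h := aux_proj (P := U * D * star U) hBP
    (by
      rw [Matrix.IsHermitian, Matrix.star_eq_conjTranspose, Matrix.conjTranspose_mul,
        Matrix.conjTranspose_mul, hDh, Matrix.conjTranspose_conjTranspose, mul_assoc])
    (by rw [hmul, hDD])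
  have ht : ((U * D * star U) * W).trace = ((∑ i ∈ S, hBP.1.eigenvalues i : ℝ) : ℂ) := by
    conv_lhs => rw [hW]
    rw [hmul, Matrix.trace_mul_comm, ← mul_assoc, hU, one_mul]
    simp [D, L, Matrix.diagonal_mul_diagonal, Matrix.trace_diagonal]
  rw [ht, htr] at h
  simp only [Complex.ofReal_re, Complex.one_re] at h
  linarith

/-- For a normalized `2 × n` entanglement witness with eigenvalues listed in
non-increasing order, `∑_{i=k}^{2n} λ_i ≥ -1/2` for each `4 ≤ k ≤ 2n`. -/
theorem stmt_8 {n : ℕ} (hn : 2 ≤ n)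
    (W : Matrix (Fin 2 × Fin n) (Fin 2 × Fin n) ℂ)
    (hBP : BlockPositive W) (hNP : ¬ W.PosSemidef) (htr : W.trace = 1) :
    ∀ k : ℕ, 4 ≤ k → k ≤ 2 * n →
      -(1 / 2) ≤ ((sortedEigs hBP.1).drop (k - 1)).sum := by
  intro k _ _
  obtain ⟨S, hS⟩ := aux_sublist hBP.1.eigenvalues ((sortedEigs hBP.1).drop (k - 1)) (by
    have h : ((sortedEigs hBP.1 : List ℝ) : Multiset ℝ) =
        Finset.univ.val.map hBP.1.eigenvalues := Multiset.sort_eq _ _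
    rw [← h]
    exact (List.drop_sublist _ _).subperm)
  rw [hS]
  exact aux_main W hBP htr S

end
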